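/- For every integer n ≥ 1, ∫_{−∞}^{∞} ( d^{n−1}/dt^{n−1} (1/cosh² t) )² dt = (−1)^{n−1} · 2^{2n+1} · B_{2n}, where B_{2n} is the (2n)-th Bernoulli number (Grosset–Veselov formula). -/

import Mathlib

open MeasureTheory

namespace GV

open Polynomial Filter Topology

/-- the umbral functional `X^k ↦ B'_k` -/
noncomputable def M : ℝ[X] →ₗ[ℝ] ℝ :=
  Polynomial.lsum (fun k => ((bernoulli' k : ℚ) : ℝ) • (LinearMap.id : ℝ →ₗ[ℝ] ℝ))

lemma M_monomial (k : ℕ) (a : ℝ) : M (monomial k a) = (bernoulli' k : ℝ) * a := by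
  simp [M, Polynomial.lsum_apply]

lemma M_X_pow (k : ℕ) : M (X ^ k) = (bernoulli' k : ℝ) := by
  rw [X_pow_eq_monomial, M_monomial, mul_one]

lemma M_shift (f : ℝ[X]) : M (f.comp (X + 1)) - M f = f.derivative.eval 1 := by
  induction f using Polynomial.induction_on' with
  | add p q hp hq => simp only [add_comp, map_add, eval_add]; linarith
  | monomial n a =>
    have h1 : (monomial n a : ℝ[X]) = a • X ^ n := by rw [smul_X_eq_monomial]
    have h2 : M ((X + 1) ^ n) - M (X ^ n) = n := by
      rw [add_pow]
      simp only [one_pow, mul_one, map_sum]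
      have : ∀ k, M (X ^ k * (n.choose k : ℝ[X])) = (n.choose k : ℝ) * bernoulli' k := by
        intro k
        have : (X ^ k * (n.choose k : ℝ[X])) = (n.choose k : ℝ) • X ^ k := by
          rw [smul_eq_C_mul, mul_comm]; simp
        rw [this, map_smul, M_X_pow, smul_eq_mul]
      simp only [this]
      rw [Finset.sum_range_succ, M_X_pow]
      have := sum_bernoulli' n
      have h := congrArg (fun q : ℚ => (q : ℝ)) this
      push_cast at h
      rw [h]; simp
    rw [h1, smul_comp, X_pow_comp, map_smul, map_smul, ← smul_sub, h2]
    rw [derivative_smul, eval_smul, derivative_X_pow]; simp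

lemma M_asc (m : ℕ) : (m + 2 : ℝ) * M (ascPochhammer ℝ (m + 1)) = ((m + 1).factorial : ℝ) := by
  have h := M_shift ((X - 1) * ascPochhammer ℝ (m + 1))
  have e1 : ((X - 1) * ascPochhammer ℝ (m + 1)).comp (X + 1) = ascPochhammer ℝ (m + 1 + 1) := by
    rw [ascPochhammer_succ_left ℝ (m + 1), mul_comp]; simp
  have e2 : ascPochhammer ℝ (m + 1 + 1) - (X - 1) * ascPochhammer ℝ (m + 1)
      = (m + 2 : ℝ) • ascPochhammer ℝ (m + 1) := by
    rw [ascPochhammer_succ_right ℝ (m + 1), smul_eq_C_mul]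
    simp only [map_add, map_natCast, map_ofNat]
    push_cast; ring
  rw [e1, ← map_sub, e2, map_smul, smul_eq_mul] at h
  rw [h]
  simp [derivative_mul, ascPochhammer_eval_one]

/-- the derivation `p ↦ (1 - X²) p'` -/
noncomputable def D : ℝ[X] →ₗ[ℝ] ℝ[X] :=
  (LinearMap.mulLeft ℝ (1 - X ^ 2)) ∘ₗ derivative

lemma D_apply (p : ℝ[X]) : D p = (1 - X ^ 2) * derivative p := rfl

lemma one_sub_tanh_sq (t : ℝ) : 1 - Real.tanh t ^ 2 = 1 / Real.cosh t ^ 2 := by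
  have := (Real.cosh_pos t).ne'
  rw [Real.tanh_eq_sinh_div_cosh]; field_simp
  linarith [Real.cosh_sq t]

lemma hasDerivAt_tanh (t : ℝ) : HasDerivAt Real.tanh (1 - Real.tanh t ^ 2) t := by
  have h := (Real.hasDerivAt_sinh t).div (Real.hasDerivAt_cosh t) (Real.cosh_pos t).ne'
  have e : Real.tanh = fun x => Real.sinh x / Real.cosh x := by
    ext x; exact Real.tanh_eq_sinh_div_cosh x
  rw [one_sub_tanh_sq, e]
  convert! h using 1
  rw [← Real.cosh_sq_sub_sinh_sq t]; ring

lemma hasDerivAt_poly (p : ℝ[X]) (t : ℝ) :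
    HasDerivAt (fun t => p.eval (Real.tanh t)) ((D p).eval (Real.tanh t)) t := by
  have := (p.hasDerivAt (Real.tanh t)).comp t (hasDerivAt_tanh t)
  convert! this using 1
  simp [D_apply]; ring

lemma continuous_tanh' : Continuous Real.tanh :=
  continuous_iff_continuousAt.2 fun t => (hasDerivAt_tanh t).continuousAt

lemma tendsto_top : Tendsto Real.tanh atTop (𝓝 1) := by
  have e : Real.tanh = fun x => 1 - 2 / (Real.exp (2 * x) + 1) := by
    ext x
    have h := Real.exp_pos x
    rw [Real.tanh_eq, Real.exp_neg, two_mul, Real.exp_add]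
    field_simp; ring
  rw [e]
  have h1 : Tendsto (fun x : ℝ => Real.exp (2 * x) + 1) atTop atTop :=
    tendsto_atTop_add_const_right _ _
      (Real.tendsto_exp_atTop.comp (tendsto_id.const_mul_atTop (by norm_num)))
  simpa using (h1.const_div_atTop 2).const_sub 1

lemma tendsto_bot : Tendsto Real.tanh atBot (𝓝 (-1)) := by
  have := (tendsto_top.comp tendsto_neg_atBot_atTop).neg
  refine this.congr fun x => ?_
  simp [Real.tanh_neg]

lemma integrable_aux (q : ℝ[X]) :
    Integrable (fun t => ((1 - X ^ 2) * q).eval (Real.tanh t)) := by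
  obtain ⟨C, hC⟩ := (isCompact_Icc (a := (-1 : ℝ)) (b := 1)).exists_bound_of_continuousOn
    (f := fun x => q.eval x) q.continuous.continuousOn
  refine Integrable.mono' (integrable_inv_one_add_sq.const_mul C) ?_ ?_
  · exact ((Polynomial.continuous _).comp continuous_tanh').aestronglyMeasurable
  · refine Eventually.of_forall fun t => ?_
    have h1 := hC (Real.tanh t) ⟨(Real.neg_one_lt_tanh t).le, (Real.tanh_lt_one t).le⟩
    have h2 : 1 + t ^ 2 ≤ Real.cosh t ^ 2 := by
      rw [Real.cosh_sq t, add_comm]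
      have : |t| ≤ |Real.sinh t| := by
        rw [Real.abs_sinh]; exact Real.self_le_sinh_iff.2 (abs_nonneg t)
      linarith [sq_le_sq.2 this]
    simp only [eval_mul, eval_sub, eval_one, eval_pow, eval_X]
    rw [one_sub_tanh_sq, norm_mul, mul_comm, one_div,
      Real.norm_of_nonneg (r := (Real.cosh t ^ 2)⁻¹) (by positivity)]
    gcongr
    exact (norm_nonneg _).trans h1

lemma integral_D (G : ℝ[X]) :
    ∫ t : ℝ, (D G).eval (Real.tanh t) = G.eval 1 - G.eval (-1) :=
  integral_of_hasDerivAt_of_tendsto (hasDerivAt_poly G) (integrable_aux _)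
    ((G.continuous.tendsto _).comp tendsto_bot) ((G.continuous.tendsto _).comp tendsto_top)

/-- weighted integral functional -/
noncomputable def L (q : ℝ[X]) : ℝ := ∫ t : ℝ, ((1 - X ^ 2) * q).eval (Real.tanh t)

lemma L_add (p q : ℝ[X]) : L (p + q) = L p + L q := by
  unfold L
  rw [← integral_add (integrable_aux p) (integrable_aux q)]
  simp only [mul_add, eval_add]

lemma L_smul (c : ℝ) (q : ℝ[X]) : L (c • q) = c * L q := by
  unfold L
  rw [← integral_const_mul]
  simp only [mul_smul_comm, eval_smul, smul_eq_mul]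

/-- basis polynomials -/
noncomputable def p (m : ℕ) : ℝ[X] := 1 - (C (1 / 2) * (1 - X)) ^ (m + 1)

lemma C_half : (C (1 / 2) : ℝ[X]) * 2 = 1 := by
  have : (2 : ℝ[X]) = C 2 := rfl
  rw [this, ← C_mul]; norm_num

lemma deriv_pow (m : ℕ) : derivative ((C (1 / 2) * (1 - X : ℝ[X])) ^ (m + 1))
    = - ((m + 1 : ℝ[X]) * C (1 / 2) * (C (1 / 2) * (1 - X)) ^ m) := by
  rw [derivative_pow]; simp; ring

lemma D_p (m : ℕ) : D (p m) = (2 * (m + 1) : ℝ) • (p (m + 1) + (-1 : ℝ) • p m) := by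
  have hc := C_half
  rw [D_apply]
  unfold p
  rw [derivative_sub, deriv_pow]
  simp only [smul_eq_C_mul, map_mul, map_add, map_natCast, map_ofNat, map_one, map_neg,
    derivative_one]
  set c : ℝ[X] := C (1 / 2)
  set w : ℝ[X] := (c * (1 - X)) ^ m with hw
  rw [pow_succ (c * (1 - X)) (m + 1), pow_succ (c * (1 - X)) m, ← hw]
  linear_combination (m + 1) * w * (1 - X) * c * (1 - X) * hc

lemma L_p (m : ℕ) : L (p m) = 2 * (m + 1) / (m + 2) := by
  have hm : (m + 2 : ℝ) ≠ 0 := by positivity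
  have h := integral_D (X + C (2 / (m + 2 : ℝ)) * (C (1 / 2) * (1 - X)) ^ (m + 1 + 1))
  have e : L (p m) =
      ∫ t : ℝ, (D (X + C (2 / (m + 2 : ℝ)) * (C (1 / 2) * (1 - X)) ^ (m + 1 + 1))).eval
        (Real.tanh t) := by
    unfold L
    congr 1; ext t; congr 1
    rw [D_apply, derivative_add, derivative_C_mul, deriv_pow (m + 1), derivative_X]
    congr 1
    have : C (2 / (m + 2 : ℝ)) * (m + 2 : ℝ[X]) * C (1 / 2) = 1 := by
      have : (m + 2 : ℝ[X]) = C (m + 2 : ℝ) := by simp; rfl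
      rw [this, ← C_mul, ← C_mul, ← C_1]
      congr 1; field_simp
    unfold p
    push_cast
    linear_combination (C (1 / 2) * (1 - X)) ^ (m + 1) * this
  rw [e, h]
  simp
  norm_num
  field_simp
  ring

lemma key (k : ℕ) : ∀ m : ℕ, 2 ^ (k + 1) * M (X ^ k * ascPochhammer ℝ (m + 1))
    = (m.factorial : ℝ) * L ((D ^ k) (p m)) := by
  induction k with
  | zero =>
    intro m
    have h := M_asc m
    have hm : (m + 2 : ℝ) ≠ 0 := by positivity
    simp only [pow_zero, one_mul, Module.End.one_apply, L_p]
    rw [Nat.factorial_succ] at h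
    push_cast at h
    field_simp
    linear_combination 2 * h
  | succ k ih =>
    intro m
    have e1 : X ^ (k + 1) * ascPochhammer ℝ (m + 1) = X ^ k * ascPochhammer ℝ (m + 1 + 1)
        - (m + 1 : ℝ) • (X ^ k * ascPochhammer ℝ (m + 1)) := by
      rw [ascPochhammer_succ_right ℝ (m + 1), smul_eq_C_mul]
      simp only [map_add, map_natCast, map_one]
      push_cast; ring
    have e2 : (D ^ (k + 1)) (p m) = (2 * (m + 1) : ℝ) •
        ((D ^ k) (p (m + 1)) + (-1 : ℝ) • (D ^ k) (p m)) := by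
      rw [pow_succ, Module.End.mul_apply, D_p, map_smul, map_add, map_smul]
    rw [e1, e2, map_sub, map_smul, smul_eq_mul, L_smul, L_add, L_smul]
    have h1 := ih m
    have h2 := ih (m + 1)
    rw [Nat.factorial_succ] at h2
    push_cast at h2
    linear_combination 2 * h2 - 2 * (m + 1) * h1

/-- derivative polynomials of tanh -/
noncomputable def P (k : ℕ) : ℝ[X] := (D ^ k) X

lemma P_succ (k : ℕ) : P (k + 1) = D (P k) := by
  unfold P; rw [pow_succ', Module.End.mul_apply]

lemma P_one : P 1 = 1 - X ^ 2 := by simp [P, D_apply]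

lemma P_eq (k : ℕ) : P (k + 1) = (2 : ℝ) • (D ^ (k + 1)) (p 0) := by
  unfold P
  rw [pow_succ, Module.End.mul_apply, Module.End.mul_apply, ← map_smul]
  congr 1
  rw [← map_smul, D_apply, D_apply]
  have : (2 : ℝ) • p 0 = 1 + X := by
    have hc := C_half
    have h2 : (C 2 : ℝ[X]) = 2 := rfl
    simp only [p, smul_eq_C_mul, h2]
    linear_combination (X - 1) * hc
  rw [this]; simp

lemma L_P (k : ℕ) : L (P (k + 1)) = 2 ^ (k + 3) * (bernoulli' (k + 2) : ℝ) := by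
  have h := key (k + 1) 0
  rw [zero_add, ascPochhammer_one, ← pow_succ, M_X_pow] at h
  rw [P_eq, L_smul]
  simp at h
  rw [← h]; ring

lemma iter (k : ℕ) : iteratedDeriv k (fun t : ℝ => 1 / Real.cosh t ^ 2)
    = fun t => (P (k + 1)).eval (Real.tanh t) := by
  induction k with
  | zero =>
    ext t
    simp only [iteratedDeriv_zero, zero_add, P_one, eval_sub, eval_one, eval_pow, eval_X]
    rw [one_sub_tanh_sq]
  | succ k ih =>
    rw [iteratedDeriv_succ, ih, P_succ (k + 1)]
    ext t
    exact (hasDerivAt_poly _ t).deriv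

lemma parts (a b : ℕ) :
    ∫ t : ℝ, (P (a + 2) * P (b + 1)).eval (Real.tanh t)
      = - ∫ t : ℝ, (P (a + 1) * P (b + 2)).eval (Real.tanh t) := by
  have h := integral_D (P (a + 1) * P (b + 1))
  have e : D (P (a + 1) * P (b + 1)) = P (a + 2) * P (b + 1) + P (a + 1) * P (b + 2) := by
    rw [P_succ (a + 1), P_succ (b + 1), D_apply, D_apply, D_apply, derivative_mul]; ring
  have i1 : Integrable (fun t => (P (a + 2) * P (b + 1)).eval (Real.tanh t)) := by
    rw [P_succ (a + 1), D_apply, mul_assoc]; exact integrable_aux _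
  have i2 : Integrable (fun t => (P (a + 1) * P (b + 2)).eval (Real.tanh t)) := by
    rw [P_succ a, D_apply, mul_assoc]; exact integrable_aux _
  rw [e] at h
  simp only [eval_add] at h
  rw [integral_add i1 i2, P_succ a, D_apply] at h
  simp at h
  rw [P_succ a, D_apply]
  simp
  linarith

lemma parts_iter (a b : ℕ) :
    ∫ t : ℝ, (P (a + 1) * P (b + 1)).eval (Real.tanh t) = (-1) ^ a * L (P (a + b + 1)) := by
  induction a generalizing b with
  | zero => simp only [zero_add, P_one, L, pow_zero, one_mul]
  | succ a ih =>
    rw [parts a b, ih (b + 1), pow_succ, show a + (b + 1) + 1 = a + 1 + b + 1 by ring]; ring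

end GV

/-- Grosset–Veselov formula: for every n ≥ 1,
∫ ( d^{n−1}/dt^{n−1} (1/cosh² t) )² dt = (−1)^{n−1} · 2^{2n+1} · B_{2n}. -/
theorem grosset_veselov (n : ℕ) (hn : 1 ≤ n) :
    ∫ t : ℝ, (iteratedDeriv (n - 1) (fun t : ℝ => 1 / Real.cosh t ^ 2) t) ^ 2 =
      (-1 : ℝ) ^ (n - 1) * 2 ^ (2 * n + 1) * (bernoulli (2 * n) : ℝ) := by
  obtain ⟨k, rfl⟩ : ∃ k, n = k + 1 := ⟨n - 1, by omega⟩
  rw [Nat.add_sub_cancel, GV.iter, bernoulli_eq_bernoulli'_of_ne_one (by omega)]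
  have h := GV.parts_iter k k
  rw [GV.L_P] at h
  simp only [← pow_two, Polynomial.eval_pow] at h
  simp only [h]
  rw [ show k + k + 3 = 2 * (k + 1) + 1 by ring, show k + k + 2 = 2 * (k + 1) by ring]
  ring
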